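/- Let a_1 < a_2 < ... < a_6 be nonnegative integers with δ_1 < δ_2 > δ_3 < δ_4 > δ_5. Then δ_2 ≠ δ_4; moreover, either δ_1 < δ_2 < δ_4 > δ_5 or δ_1 < δ_2 > δ_4 > δ_5 holds. -/

import Mathlib

/-- For distinct nonnegative integers `a` and `b`, `bdelta a b` is the largest index `i`
such that the `i`-th binary digits of `a` and `b` differ. -/
noncomputable def bdelta (a b : ℕ) : ℕ := sSup {i | a.testBit i ≠ b.testBit i}

theorem bddAbove_setOf_testBit_ne (a b : ℕ) : BddAbove {i | a.testBit i ≠ b.testBit i} := by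
  refine ⟨a + b, fun i hi => ?_⟩
  by_contra! hlt
  have hpow : i < 2 ^ i := Nat.lt_two_pow_self
  exact hi (by rw [Nat.testBit_lt_two_pow (by omega), Nat.testBit_lt_two_pow (by omega)])

theorem testBit_eq_of_bdelta_lt {a b i : ℕ} (h : bdelta a b < i) :
    a.testBit i = b.testBit i := by
  by_contra hne
  exact absurd (le_csSup (bddAbove_setOf_testBit_ne a b) hne) (not_le.mpr h)

theorem testBit_bdelta_ne {a b : ℕ} (h : a ≠ b) :
    a.testBit (bdelta a b) ≠ b.testBit (bdelta a b) :=
  Nat.sSup_mem (s := {i | a.testBit i ≠ b.testBit i}) (Nat.exists_testBit_ne_of_ne h)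
    (bddAbove_setOf_testBit_ne a b)

theorem testBit_bdelta_of_lt {a b : ℕ} (h : a < b) :
    a.testBit (bdelta a b) = false ∧ b.testBit (bdelta a b) = true := by
  have hne := testBit_bdelta_ne h.ne
  cases ha : a.testBit (bdelta a b) <;> cases hb : b.testBit (bdelta a b)
  · simp [ha, hb] at hne
  · simp
  · exact absurd (Nat.lt_of_testBit _ hb ha fun j hj => (testBit_eq_of_bdelta_lt hj).symm)
      h.not_gt
  · simp [ha, hb] at hne

/-- Let `a₁ < ⋯ < a₆` be nonnegative integers with `δ₁ < δ₂ > δ₃ < δ₄ > δ₅`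
(where `δᵢ = δ(aᵢ, aᵢ₊₁)`). Then `δ₂ ≠ δ₄`; moreover either `δ₁ < δ₂ < δ₄ > δ₅` or
`δ₁ < δ₂ > δ₄ > δ₅` holds. -/
theorem stmt9 (a1 a2 a3 a4 a5 a6 : ℕ)
    (h12 : a1 < a2) (h23 : a2 < a3) (h34 : a3 < a4) (h45 : a4 < a5) (h56 : a5 < a6)
    (hd1 : bdelta a1 a2 < bdelta a2 a3)
    (hd2 : bdelta a3 a4 < bdelta a2 a3)
    (hd3 : bdelta a3 a4 < bdelta a4 a5)
    (hd4 : bdelta a5 a6 < bdelta a4 a5) :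
    bdelta a2 a3 ≠ bdelta a4 a5 ∧
      ((bdelta a1 a2 < bdelta a2 a3 ∧ bdelta a2 a3 < bdelta a4 a5 ∧
          bdelta a5 a6 < bdelta a4 a5) ∨
        (bdelta a1 a2 < bdelta a2 a3 ∧ bdelta a4 a5 < bdelta a2 a3 ∧
          bdelta a5 a6 < bdelta a4 a5)) := by
  have hne : bdelta a2 a3 ≠ bdelta a4 a5 := by
    intro heq
    have h3 := (testBit_bdelta_of_lt h23).2
    have h4 := (testBit_bdelta_of_lt h45).1
    rw [testBit_eq_of_bdelta_lt hd2, heq, h4] at h3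
    exact Bool.false_ne_true h3
  refine ⟨hne, ?_⟩
  rcases hne.lt_or_gt with h | h
  · exact Or.inl ⟨hd1, h, hd4⟩
  · exact Or.inr ⟨hd1, h, hd4⟩
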